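/- arXiv:1510.08043 — 9 statements merged into one kernel-verified Lean document; each statement's English description precedes it below -/
import Mathlib

section
/- Let A > 0 and κ ∈ ℝ, and let D be the diagonal linear map on the Heisenberg Lie algebra 𝔥₃ with D e₁ = (A²/16 − κ) e₁, D e₂ = (−3A²/16 − κ) e₂, D e₃ = (−3A²/16 − κ) e₃. Then D is a derivation of 𝔥₃ if and only if κ = −7A²/16. In particular, for every A > 0 there is a (necessarily negative) κ such that D is a derivation, so every left-invariant metric A θ¹⊗θ¹ + θ²⊗θ² + θ³⊗θ³ on the Heisenberg group is a shrinking algebraic soliton for the positive cross curvature flow. -/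
noncomputable section

/-- The bracket on the 3-dimensional real Lie algebra with Milnor-type structure constants
`⁅e₂, e₃⁆ = l1 • e₁`, `⁅e₃, e₁⁆ = l2 • e₂`, `⁅e₁, e₂⁆ = l3 • e₃` (indices `0, 1, 2`
stand for `e₁, e₂, e₃`). -/
def bra (l1 l2 l3 : ℝ) (x y : Fin 3 → ℝ) : Fin 3 → ℝ :=
  ![l1 * (x 1 * y 2 - x 2 * y 1),
    l2 * (x 2 * y 0 - x 0 * y 2),
    l3 * (x 0 * y 1 - x 1 * y 0)]

/-- The diagonal linear map sending `eᵢ ↦ t i • eᵢ`. -/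
def diagMap (t : Fin 3 → ℝ) (x : Fin 3 → ℝ) : Fin 3 → ℝ := fun i => t i * x i

/-- `D` is a derivation with respect to the bracket `br`. -/
def IsDerivation (br : (Fin 3 → ℝ) → (Fin 3 → ℝ) → (Fin 3 → ℝ))
    (D : (Fin 3 → ℝ) → (Fin 3 → ℝ)) : Prop :=
  ∀ x y, D (br x y) = br (D x) y + br x (D y)

/-- A diagonal map is a derivation of the Heisenberg Lie algebra iff its weight on the center is
the sum of its other two weights. -/
theorem isDerivation_heisenberg_diagMap_iff (t : Fin 3 → ℝ) :
    IsDerivation (bra 1 0 0) (diagMap t) ↔ t 0 = t 1 + t 2 := by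
  constructor
  · intro h
    simpa [bra, diagMap] using congrFun (h ![0, 1, 0] ![0, 0, 1]) 0
  · intro h x y
    ext i
    fin_cases i
    · simp [bra, diagMap, h]
      ring
    · simp [bra, diagMap]
    · simp [bra, diagMap]

/-- For `A > 0`, the diagonal map on the Heisenberg Lie algebra with entries
`A²/16 - κ, -3A²/16 - κ, -3A²/16 - κ` (the cross curvature operator minus `κ·Id` for the
metric `A θ¹⊗θ¹ + θ²⊗θ² + θ³⊗θ³`) is a derivation iff `κ = -7A²/16`; in particular there is
always a negative `κ` making it a derivation, so every such metric is a shrinking algebraic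
soliton for the positive cross curvature flow. -/
theorem heisenberg_xcf_soliton (A κ : ℝ) (hA : 0 < A) :
    (IsDerivation (bra 1 0 0)
        (diagMap ![A ^ 2 / 16 - κ, -3 * A ^ 2 / 16 - κ, -3 * A ^ 2 / 16 - κ]) ↔
      κ = -7 * A ^ 2 / 16) ∧
    ∃ κ' : ℝ, κ' < 0 ∧
      IsDerivation (bra 1 0 0)
        (diagMap ![A ^ 2 / 16 - κ', -3 * A ^ 2 / 16 - κ', -3 * A ^ 2 / 16 - κ']) := by
  have key (k : ℝ) : IsDerivation (bra 1 0 0)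
      (diagMap ![A ^ 2 / 16 - k, -3 * A ^ 2 / 16 - k, -3 * A ^ 2 / 16 - k]) ↔
        k = -7 * A ^ 2 / 16 := by
    rw [isDerivation_heisenberg_diagMap_iff]
    change A ^ 2 / 16 - k = (-3 * A ^ 2 / 16 - k) + (-3 * A ^ 2 / 16 - k) ↔ _
    constructor <;> intro h <;> linarith
  refine ⟨key κ, -7 * A ^ 2 / 16, ?_, (key _).2 rfl⟩
  have := pow_pos hA 2
  linarith
end
end

section
/- Let B, C > 0 and set K₁ = (B+3)(B−1)/(4BC), K₂ = (3B+1)(1−B)/(4BC), K₃ = (B−1)²/(4BC). Then there exists κ ∈ ℝ such that the diagonal linear map on 𝔢(2) with D e₁ = (K₂K₃ − κ) e₁, D e₂ = (K₃K₁ − κ) e₂, D e₃ = (K₁K₂ − κ) e₃ is a derivation of 𝔢(2) if and only if B = 1. In particular, the flat metrics (B = 1) are the only algebraic solitons for the cross curvature flow on E(2). -/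
noncomputable section

/-- For `B, C > 0` and the principal sectional curvatures `K₁, K₂, K₃` of
the metric `θ¹⊗θ¹ + B θ²⊗θ² + C θ³⊗θ³` on `E(2)`, there is a `κ` making the diagonal map
with entries `K₂K₃ - κ, K₃K₁ - κ, K₁K₂ - κ` a derivation of `𝔢(2)` iff `B = 1`: the flat
metrics are the only algebraic solitons for the cross curvature flow on `E(2)`. -/
theorem e2_xcf_soliton_iff_flat (B C K1 K2 K3 : ℝ) (hB : 0 < B) (hC : 0 < C)
    (hK1 : K1 = (B + 3) * (B - 1) / (4 * B * C))
    (hK2 : K2 = (3 * B + 1) * (1 - B) / (4 * B * C))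
    (hK3 : K3 = (B - 1) ^ 2 / (4 * B * C)) :
    (∃ κ : ℝ, IsDerivation (bra 1 1 0)
        (diagMap ![K2 * K3 - κ, K3 * K1 - κ, K1 * K2 - κ])) ↔ B = 1 := by
  constructor
  · rintro ⟨κ, h⟩
    have h₁ := congrFun (h ![0, 1, 0] ![0, 0, 1]) 0
    have h₂ := congrFun (h ![0, 0, 1] ![1, 0, 0]) 1
    simp [bra, diagMap] at h₁ h₂
    have hK : K3 * (K1 - K2) = 0 := by linarith
    have hd : 4 * B * C ≠ 0 := by positivity
    rcases mul_eq_zero.mp hK with h₃ | h₁₂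
    · rw [hK3, div_eq_zero_iff] at h₃
      have := pow_eq_zero_iff (two_ne_zero) |>.mp (h₃.resolve_right hd)
      linarith
    · rw [hK1, hK2, ← sub_div, div_eq_zero_iff] at h₁₂
      have hfac : (B + 1) * (B - 1) = 0 := by linarith [h₁₂.resolve_right hd]
      rcases mul_eq_zero.mp hfac with h | h <;> linarith
  · rintro rfl
    refine ⟨0, fun x y => ?_⟩
    ext i
    fin_cases i <;> simp [bra, diagMap, hK1, hK2, hK3]
end
end

section
/- Let B, C > 0, let α ∈ ℝ, and set K₁ = (B+3)(B−1)/(4BC), K₂ = (3B+1)(1−B)/(4BC), K₃ = (B−1)²/(4BC). Then the diagonal linear map on 𝔢(2) with D e₁ = (−2(K₂+K₃) − α(K₂²+K₃²)) e₁, D e₂ = (−2(K₃+K₁) − α(K₃²+K₁²)) e₂, D e₃ = (−2(K₁+K₂) − α(K₁²+K₂²)) e₃ is a derivation of 𝔢(2) if and only if B = 1. In particular, the flat metrics are the only left-invariant steady algebraic solitons for the second order renormalization group flow on E(2). -/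
noncomputable section

/-- A diagonal map `diag t` is a derivation of `𝔢(2)` iff `t₃ = 0` and `t₁ = t₂`. -/
theorem isDerivation_bra_one_one_zero_diagMap_iff (t : Fin 3 → ℝ) :
    IsDerivation (bra 1 1 0) (diagMap t) ↔ t 2 = 0 ∧ t 0 = t 1 := by
  constructor
  · intro h
    have h0 := congrFun (h ![0, 1, 0] ![0, 0, 1]) 0
    have h1 := congrFun (h ![0, 0, 1] ![1, 0, 0]) 1
    simp [bra, diagMap] at h0 h1
    constructor <;> linarith
  · rintro ⟨h2, h01⟩ x y
    ext i
    fin_cases i <;> simp [bra, diagMap, h2, h01] <;> ring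

/-- For `B, C > 0`, `α : ℝ`, and the principal sectional curvatures
`K₁, K₂, K₃` of the metric `θ¹⊗θ¹ + B θ²⊗θ² + C θ³⊗θ³` on `E(2)`, the diagonal map given by
the RG-2 operator is a derivation of `𝔢(2)` iff `B = 1`: the flat metrics are the only
left-invariant steady algebraic RG-2 solitons on `E(2)`. -/
theorem e2_rg2_soliton_iff_flat (B C α K1 K2 K3 : ℝ) (hB : 0 < B) (hC : 0 < C)
    (hK1 : K1 = (B + 3) * (B - 1) / (4 * B * C))
    (hK2 : K2 = (3 * B + 1) * (1 - B) / (4 * B * C))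
    (hK3 : K3 = (B - 1) ^ 2 / (4 * B * C)) :
    IsDerivation (bra 1 1 0)
      (diagMap ![-2 * (K2 + K3) - α * (K2 ^ 2 + K3 ^ 2),
                 -2 * (K3 + K1) - α * (K3 ^ 2 + K1 ^ 2),
                 -2 * (K1 + K2) - α * (K1 ^ 2 + K2 ^ 2)]) ↔ B = 1 := by
  rw [isDerivation_bra_one_one_zero_diagMap_iff]
  simp only [Matrix.cons_val]
  constructor
  · rintro ⟨h2, h01⟩
    by_contra hne
    have hB1 : B - 1 ≠ 0 := sub_ne_zero.mpr hne
    have hsub : K2 - K1 ≠ 0 := by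
      have : K2 - K1 = -((B - 1) * (B + 1)) / (B * C) := by
        rw [hK1, hK2]; field_simp; ring
      rw [this]
      have : B + 1 ≠ 0 := by positivity
      simp [hB1, this, hB.ne', hC.ne']
    have hmul : K1 * K2 ≠ 0 := by
      rw [hK1, hK2]
      have h3 : B + 3 ≠ 0 := by positivity
      have h4 : 3 * B + 1 ≠ 0 := by positivity
      have h5 : 1 - B ≠ 0 := sub_ne_zero.mpr (Ne.symm hne)
      have h6 : 4 * B * C ≠ 0 := by positivity
      exact mul_ne_zero (div_ne_zero (mul_ne_zero h3 hB1) h6)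
        (div_ne_zero (mul_ne_zero h4 h5) h6)
    have hsum : 2 + α * (K1 + K2) = 0 :=
      mul_left_cancel₀ hsub (by linear_combination -h01)
    exact hmul (by linear_combination -(K1 + K2) / 4 * h2 - (K1 ^ 2 + K2 ^ 2) / 4 * hsum)
  · rintro rfl
    simp [hK1, hK2, hK3]
end
end

section
/- Let A, B > 0 and set K₁ = −(A+1)(3A−1)/(4AB), K₂ = (A+1)²/(4AB), K₃ = (A+1)(A−3)/(4AB). Then there exists κ ∈ ℝ such that the diagonal linear map on 𝔢(1,1) with D e₁ = (K₂K₃ − κ) e₁, D e₂ = (K₃K₁ − κ) e₂, D e₃ = (K₁K₂ − κ) e₃ is a derivation of 𝔢(1,1) if and only if A = 1; moreover, in that case the unique such κ is κ = 1/B² > 0. Hence the metric A θ¹⊗θ¹ + B θ²⊗θ² + θ³⊗θ³ on E(1,1) is an expanding algebraic soliton for the positive cross curvature flow exactly when A = 1. -/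
noncomputable section

/-- A diagonal map is a derivation of `𝔢(1,1)` iff it kills `e₂` and has equal eigenvalues
on `e₁` and `e₃`. -/
theorem isDerivation_diagMap_iff (a b c : ℝ) :
    IsDerivation (bra 1 0 (-1)) (diagMap ![a, b, c]) ↔ b = 0 ∧ a = c := by
  constructor
  · intro h
    have h1 := congrFun (h ![0, 1, 0] ![0, 0, 1]) 0
    have h2 := congrFun (h ![1, 0, 0] ![0, 1, 0]) 2
    simp [bra, diagMap] at h1 h2
    constructor <;> linarith
  · rintro ⟨rfl, rfl⟩ x y
    ext i
    fin_cases i <;> simp [bra, diagMap] <;> ring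

/-- For `A, B > 0` and the principal sectional curvatures `K₁, K₂, K₃` of
the metric `A θ¹⊗θ¹ + B θ²⊗θ² + θ³⊗θ³` on `E(1,1)`, there is a `κ` making the diagonal map
with entries `K₂K₃ - κ, K₃K₁ - κ, K₁K₂ - κ` a derivation of `𝔢(1,1)` iff `A = 1`; moreover
in that case the unique such `κ` is `κ = 1/B² > 0`, so the metric is an expanding algebraic
soliton for the positive cross curvature flow exactly when `A = 1`. -/
theorem e11_xcf_soliton (A B K1 K2 K3 : ℝ) (hA : 0 < A) (hB : 0 < B)
    (hK1 : K1 = -((A + 1) * (3 * A - 1)) / (4 * A * B))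
    (hK2 : K2 = (A + 1) ^ 2 / (4 * A * B))
    (hK3 : K3 = (A + 1) * (A - 3) / (4 * A * B)) :
    ((∃ κ : ℝ, IsDerivation (bra 1 0 (-1))
        (diagMap ![K2 * K3 - κ, K3 * K1 - κ, K1 * K2 - κ])) ↔ A = 1) ∧
    (A = 1 → ∀ κ : ℝ,
      (IsDerivation (bra 1 0 (-1))
        (diagMap ![K2 * K3 - κ, K3 * K1 - κ, K1 * K2 - κ]) ↔ κ = 1 / B ^ 2)) ∧
    0 < 1 / B ^ 2 := by
  simp only [isDerivation_diagMap_iff, sub_eq_zero, sub_left_inj]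
  have hK2_pos : 0 < K2 := by rw [hK2]; positivity
  have h_eq : K2 * K3 = K1 * K2 ↔ A = 1 := by
    rw [mul_comm K1, mul_right_inj' hK2_pos.ne', hK1, hK3, div_left_inj' (by positivity)]
    constructor
    · intro h
      have h_fac : (A + 1) * (A - 1) = 0 := by linarith
      rcases mul_eq_zero.mp h_fac with h | h <;> linarith
    · rintro rfl
      norm_num
  refine ⟨⟨fun ⟨_, _, h⟩ => h_eq.mp h, fun h => ⟨_, rfl, h_eq.mpr h⟩⟩, fun h κ => ?_,
    by positivity⟩
  have hK : K3 * K1 = 1 / B ^ 2 := by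
    rw [hK1, hK3, h]
    field_simp
    norm_num
  rw [hK, and_iff_left (h_eq.mpr h), eq_comm]
end
end

section
/- Let A, B > 0, let α ∈ ℝ, and set K₁ = −(A+1)(3A−1)/(4AB), K₂ = (A+1)²/(4AB), K₃ = (A+1)(A−3)/(4AB). Then the diagonal linear map on 𝔢(1,1) with D e₁ = (−2(K₂+K₃) − α(K₂²+K₃²)) e₁, D e₂ = (−2(K₃+K₁) − α(K₃²+K₁²)) e₂, D e₃ = (−2(K₁+K₂) − α(K₁²+K₂²)) e₃ is a derivation of 𝔢(1,1) if and only if either (1) A = 1 and α = 2B, or (2) A = 1/3 or A = 3, and α = (3/4)B. Hence these are exactly the steady algebraic solitons for the second order renormalization group flow on E(1,1). -/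
noncomputable section

/-- A diagonal map is a derivation of a Milnor-type bracket iff `tᵢ = tⱼ + tₖ` whenever the
structure constant of `⁅eⱼ, eₖ⁆` is nonzero. -/
theorem isDerivation_bra_diagMap_iff (l1 l2 l3 : ℝ) (t : Fin 3 → ℝ) :
    IsDerivation (bra l1 l2 l3) (diagMap t) ↔
      l1 * (t 0 - t 1 - t 2) = 0 ∧ l2 * (t 1 - t 2 - t 0) = 0 ∧ l3 * (t 2 - t 0 - t 1) = 0 := by
  constructor
  · intro h
    have h1 := congrFun (h ![0, 1, 0] ![0, 0, 1]) 0
    have h2 := congrFun (h ![0, 0, 1] ![1, 0, 0]) 1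
    have h3 := congrFun (h ![1, 0, 0] ![0, 1, 0]) 2
    simp [bra, diagMap] at h1 h2 h3
    exact ⟨by linear_combination h1, by linear_combination h2, by linear_combination h3⟩
  · rintro ⟨h1, h2, h3⟩ x y
    ext i
    fin_cases i
    · simp [bra, diagMap]
      linear_combination (x 1 * y 2 - x 2 * y 1) * h1
    · simp [bra, diagMap]
      linear_combination (x 2 * y 0 - x 0 * y 2) * h2
    · simp [bra, diagMap]
      linear_combination (x 0 * y 1 - x 1 * y 0) * h3

/-- For `A, B > 0`, `α : ℝ`, and the principal sectional curvatures
`K₁, K₂, K₃` of the metric `A θ¹⊗θ¹ + B θ²⊗θ² + θ³⊗θ³` on `E(1,1)`, the diagonal map given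
by the RG-2 operator is a derivation of `𝔢(1,1)` iff `A = 1` and `α = 2B`, or
(`A = 1/3` or `A = 3`) and `α = (3/4)B`. -/
theorem e11_rg2_soliton (A B α K1 K2 K3 : ℝ) (hA : 0 < A) (hB : 0 < B)
    (hK1 : K1 = -((A + 1) * (3 * A - 1)) / (4 * A * B))
    (hK2 : K2 = (A + 1) ^ 2 / (4 * A * B))
    (hK3 : K3 = (A + 1) * (A - 3) / (4 * A * B)) :
    IsDerivation (bra 1 0 (-1))
      (diagMap ![-2 * (K2 + K3) - α * (K2 ^ 2 + K3 ^ 2),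
                 -2 * (K3 + K1) - α * (K3 ^ 2 + K1 ^ 2),
                 -2 * (K1 + K2) - α * (K1 ^ 2 + K2 ^ 2)]) ↔
      ((A = 1 ∧ α = 2 * B) ∨ ((A = 1 / 3 ∨ A = 3) ∧ α = (3 / 4) * B)) := by
  obtain ⟨s, hs⟩ : ∃ s, s = (A + 1) / (4 * A * B) := ⟨_, rfl⟩
  have hs0 : 0 < s := hs ▸ by positivity
  have hsAB : 4 * A * B * s = A + 1 := by rw [hs]; field_simp
  have h1 : K1 = -(s * (3 * A - 1)) := by rw [hK1, hs]; ring
  have h2 : K2 = s * (A + 1) := by rw [hK2, hs]; ring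
  have h3 : K3 = s * (A - 3) := by rw [hK3, hs]; ring
  clear hK1 hK2 hK3 hs
  subst h1 h2 h3
  rw [isDerivation_bra_diagMap_iff]
  simp only [Matrix.cons_val_zero, Matrix.cons_val_one, Matrix.cons_val, zero_mul, true_and]
  constructor
  · rintro ⟨e1, e3⟩
    have htrace : s * (α * s * (10 * A ^ 2 - 12 * A + 10) - 4 * (A + 1)) = 0 := by
      linear_combination (e1 - e3) / 2
    have hdiff : s * ((A - 1) * (α * s * (A + 1) - 1)) = 0 := by
      linear_combination (e1 + e3) / 16
    have htrace' := (mul_eq_zero.mp htrace).resolve_left hs0.ne'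
    rcases mul_eq_zero.mp ((mul_eq_zero.mp hdiff).resolve_left hs0.ne') with h | h
    · obtain rfl : A = 1 := by linarith
      refine Or.inl ⟨rfl, ?_⟩
      linear_combination (B / 4) * htrace' - α / 2 * hsAB
    · right
      have hquad : (3 * A - 1) * (A - 3) = 0 := by
        linear_combination (A + 1) / 2 * htrace' - (5 * A ^ 2 - 6 * A + 5) * h
      rcases mul_eq_zero.mp hquad with hA' | hA'
      · obtain rfl : A = 1 / 3 := by linarith
        refine ⟨Or.inl rfl, ?_⟩
        linear_combination (3 / 4 * B) * h - 3 / 4 * α * hsAB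
      · obtain rfl : A = 3 := by linarith
        refine ⟨Or.inr rfl, ?_⟩
        linear_combination (3 / 4 * B) * h - 1 / 4 * α * hsAB
  · rintro (⟨rfl, rfl⟩ | ⟨rfl | rfl, rfl⟩)
    · obtain rfl : s = 1 / (2 * B) := by field_simp; linarith
      constructor <;> field_simp <;> ring
    · obtain rfl : s = 1 / B := by field_simp; linarith
      constructor <;> field_simp <;> ring
    · obtain rfl : s = 1 / (3 * B) := by field_simp; linarith
      constructor <;> field_simp <;> ring
end
end

section
/- Let A, B, C > 0, set λ̃₁ = √(A/(BC)), λ̃₂ = √(B/(AC)), λ̃₃ = −√(C/(AB)), μ̃ᵢ = (λ̃₁+λ̃₂+λ̃₃)/2 − λ̃ᵢ, and Kₗ = λ̃ₗ μ̃ₗ − μ̃ₘ μ̃ₙ for (l,m,n) a cyclic permutation of (1,2,3). Then there is no κ ∈ ℝ such that the diagonal linear map on 𝔰𝔩(2,ℝ) with D e₁ = (K₂K₃ − κ) e₁, D e₂ = (K₃K₁ − κ) e₂, D e₃ = (K₁K₂ − κ) e₃ is a derivation of 𝔰𝔩(2,ℝ). Hence the universal cover of SL(2,ℝ) supports no left-invariant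 algebraic soliton for the cross curvature flow. -/
noncomputable section

/-- A diagonal derivation of `𝔰𝔩(2,ℝ)` in a Milnor frame vanishes. -/
lemma eq_zero_of_isDerivation_diagMap {a b c : ℝ}
    (h : IsDerivation (bra 1 1 (-1)) (diagMap ![a, b, c])) : a = 0 ∧ b = 0 ∧ c = 0 := by
  have h1 := congrFun (h ![0, 1, 0] ![0, 0, 1]) 0
  have h2 := congrFun (h ![0, 0, 1] ![1, 0, 0]) 1
  have h3 := congrFun (h ![1, 0, 0] ![0, 1, 0]) 2
  simp [bra, diagMap] at h1 h2 h3
  refine ⟨?_, ?_, ?_⟩ <;> linarith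

/-- The pairwise products of the principal curvatures, written in terms of `μ̃₁, μ̃₂, μ̃₃`, cannot
all agree under the sign conditions `λ̃₁ > 0`, `λ̃₂ > 0`, `λ̃₃ < 0`. -/
lemma curvature_products_not_all_eq {x y z k1 k2 k3 κ : ℝ}
    (hyz : 0 < y + z) (hxz : 0 < x + z) (hxy : x + y < 0)
    (e1 : k1 = x * y + x * z - y * z) (e2 : k2 = x * y + y * z - x * z)
    (e3 : k3 = x * z + y * z - x * y)
    (h1 : k2 * k3 = κ) (h2 : k3 * k1 = κ) (h3 : k1 * k2 = κ) : False := by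
  have hz : 0 < z := by linarith
  have not_both : x = 0 → y = 0 → False := fun hx hy => by linarith
  have d3 : k3 * (k1 - k2) = 0 := by linarith
  have d1 : k1 * (k2 - k3) = 0 := by linarith
  have x_ne (hx : x = 0) (hk : k1 = 0) : False := by
    subst hx
    have : y * z = 0 := by linarith
    exact not_both rfl ((mul_eq_zero.mp this).resolve_right hz.ne')
  have y_ne (hy : y = 0) (hk : k2 = 0) : False := by
    subst hy
    have : x * z = 0 := by linarith
    exact not_both ((mul_eq_zero.mp this).resolve_right hz.ne') rfl
  have h12 (hk1 : k1 = 0) (hk2 : k2 = 0) : False := by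
    have : x * y = 0 := by linarith
    exact (mul_eq_zero.mp this).elim (x_ne · hk1) (y_ne · hk2)
  have h13 (hk1 : k1 = 0) (hk3 : k3 = 0) : False := by
    have : x * z = 0 := by linarith
    exact x_ne ((mul_eq_zero.mp this).resolve_right hz.ne') hk1
  have h23 (hk2 : k2 = 0) (hk3 : k3 = 0) : False := by
    have : y * z = 0 := by linarith
    exact y_ne ((mul_eq_zero.mp this).resolve_right hz.ne') hk2
  have heq (h12 : k1 = k2) (h23 : k2 = k3) : False := by
    have hxy' : z * (x - y) = 0 := by linarith
    have hx : x = y := sub_eq_zero.mp ((mul_eq_zero.mp hxy').resolve_left hz.ne')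
    have hyz' : x * (y - z) = 0 := by linarith
    rcases mul_eq_zero.mp hyz' with h | h <;> linarith
  rcases mul_eq_zero.mp d3 with hk3 | hk12
  · rcases mul_eq_zero.mp d1 with hk1 | hk23
    · exact h13 hk1 hk3
    · exact h23 (by linarith) hk3
  · rcases mul_eq_zero.mp d1 with hk1 | hk23
    · exact h12 hk1 (by linarith)
    · exact heq (by linarith) (by linarith)

/-- For `A, B, C > 0` and the principal sectional curvatures `K₁, K₂, K₃`
of the metric `A θ¹⊗θ¹ + B θ²⊗θ² + C θ³⊗θ³` on the universal cover of `SL(2,ℝ)`, there is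
no `κ` making the diagonal map with entries `K₂K₃ - κ, K₃K₁ - κ, K₁K₂ - κ` a derivation of
`𝔰𝔩(2,ℝ)`: no left-invariant algebraic soliton for the cross curvature flow exists. -/
theorem sl2_no_xcf_soliton (A B C l1 l2 l3 m1 m2 m3 K1 K2 K3 : ℝ)
    (hA : 0 < A) (hB : 0 < B) (hC : 0 < C)
    (hl1 : l1 = Real.sqrt (A / (B * C)))
    (hl2 : l2 = Real.sqrt (B / (A * C)))
    (hl3 : l3 = -Real.sqrt (C / (A * B)))
    (hm1 : m1 = (l1 + l2 + l3) / 2 - l1)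
    (hm2 : m2 = (l1 + l2 + l3) / 2 - l2)
    (hm3 : m3 = (l1 + l2 + l3) / 2 - l3)
    (hK1 : K1 = l1 * m1 - m2 * m3)
    (hK2 : K2 = l2 * m2 - m3 * m1)
    (hK3 : K3 = l3 * m3 - m1 * m2) :
    ¬ ∃ κ : ℝ, IsDerivation (bra 1 1 (-1))
        (diagMap ![K2 * K3 - κ, K3 * K1 - κ, K1 * K2 - κ]) := by
  rintro ⟨κ, hκ⟩
  obtain ⟨h1, h2, h3⟩ := eq_zero_of_isDerivation_diagMap hκ
  have p1 : 0 < l1 := hl1 ▸ Real.sqrt_pos.mpr (by positivity)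
  have p2 : 0 < l2 := hl2 ▸ Real.sqrt_pos.mpr (by positivity)
  have p3 : l3 < 0 := hl3 ▸ neg_neg_of_pos (Real.sqrt_pos.mpr (by positivity))
  have e1 : l1 = m2 + m3 := by linarith
  have e2 : l2 = m1 + m3 := by linarith
  have e3 : l3 = m1 + m2 := by linarith
  refine curvature_products_not_all_eq (e1 ▸ p1) (e2 ▸ p2) (e3 ▸ p3) ?_ ?_ ?_
    (sub_eq_zero.mp h1) (sub_eq_zero.mp h2) (sub_eq_zero.mp h3)
  · rw [hK1, e1]; ring
  · rw [hK2, e2]; ring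
  · rw [hK3, e3]; ring
end
end

section
/- Let A, B, C > 0 and set K₁ = −(3A² − B² + 2BC − C² − 2AB − 2AC)/(4ABC), K₂ = (A² − 3B² + C² + 2AB + 2BC − 2AC)/(4ABC), K₃ = (A² + B² − 3C² − 2AB + 2BC + 2AC)/(4ABC). Then there exists κ ∈ ℝ such that the diagonal linear map on 𝔰𝔲(2) with D e₁ = (K₂K₃ − κ) e₁, D e₂ = (K₃K₁ − κ) e₂, D e₃ = (K₁K₂ − κ) e₃ is a derivation of 𝔰𝔲(2) if and only if A = B = C. Hence a left-invariant metric on SU(2) is an algebraic soliton for the cross curvature flow if and only if it has constant sectional curvature. -/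
noncomputable section

/-- A diagonal map is a derivation of `𝔰𝔲(2)` if and only if it vanishes. -/
theorem isDerivation_bra_one_diagMap_iff (t : Fin 3 → ℝ) :
    IsDerivation (bra 1 1 1) (diagMap t) ↔ t = 0 := by
  constructor
  · intro h
    have h0 := congrFun (h ![0, 1, 0] ![0, 0, 1]) 0
    have h1 := congrFun (h ![0, 0, 1] ![1, 0, 0]) 1
    have h2 := congrFun (h ![1, 0, 0] ![0, 1, 0]) 2
    simp [bra, diagMap] at h0 h1 h2
    ext i
    fin_cases i <;> simp <;> linarith
  · rintro rfl x y
    ext i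
    fin_cases i <;> simp [bra, diagMap]

/-- For a left-invariant metric on `SU(2)`, no two principal sectional curvatures vanish
simultaneously, stated for the numerators of the curvatures. -/
theorem not_two_curvatures_eq_zero {A B C : ℝ} (hA : 0 < A) (hB : 0 < B) (hC : 0 < C)
    (h1 : (B - C) ^ 2 - 3 * A ^ 2 + 2 * A * B + 2 * A * C = 0)
    (h2 : (C - A) ^ 2 - 3 * B ^ 2 + 2 * B * C + 2 * B * A = 0) : False := by
  have hs : (B + C - A) * (C + A - B) = 0 := by linear_combination (h1 + h2) / 2
  have hd : (B - A) * (A + B - C) = 0 := by linear_combination (h1 - h2) / 4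
  rcases mul_eq_zero.mp hs with h | h <;> rcases mul_eq_zero.mp hd with h' | h' <;> linarith

/-- A left-invariant metric on `SU(2)` whose principal sectional curvatures (given by their
numerators) agree is a multiple of the round one. -/
theorem eq_of_curvatures_eq {A B C : ℝ} (hA : 0 < A) (hB : 0 < B) (hC : 0 < C)
    (h12 : (B - C) ^ 2 - 3 * A ^ 2 + 2 * A * B + 2 * A * C =
      (C - A) ^ 2 - 3 * B ^ 2 + 2 * B * C + 2 * B * A)
    (h23 : (C - A) ^ 2 - 3 * B ^ 2 + 2 * B * C + 2 * B * A =
      (A - B) ^ 2 - 3 * C ^ 2 + 2 * C * A + 2 * C * B) : A = B ∧ B = C := by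
  have h1 : (B - A) * (A + B - C) = 0 := by linear_combination h12 / 4
  have h2 : (C - B) * (B + C - A) = 0 := by linear_combination h23 / 4
  have h3 : (A - C) * (C + A - B) = 0 := by linear_combination -(h12 + h23) / 4
  rcases mul_eq_zero.mp h1 with h | h <;> rcases mul_eq_zero.mp h2 with h' | h' <;>
    rcases mul_eq_zero.mp h3 with h'' | h'' <;> constructor <;> linarith

/-- For `A, B, C > 0` and the principal sectional curvatures `K₁, K₂, K₃`
of the metric `A θ¹⊗θ¹ + B θ²⊗θ² + C θ³⊗θ³` on `SU(2)`, there is a `κ` making the diagonal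
map with entries `K₂K₃ - κ, K₃K₁ - κ, K₁K₂ - κ` a derivation of `𝔰𝔲(2)` iff `A = B = C`:
a left-invariant metric on `SU(2)` is an algebraic soliton for the cross curvature flow iff
it has constant sectional curvature. -/
theorem su2_xcf_soliton_iff (A B C K1 K2 K3 : ℝ) (hA : 0 < A) (hB : 0 < B) (hC : 0 < C)
    (hK1 : K1 = -(3 * A ^ 2 - B ^ 2 + 2 * B * C - C ^ 2 - 2 * A * B - 2 * A * C) / (4 * A * B * C))
    (hK2 : K2 = (A ^ 2 - 3 * B ^ 2 + C ^ 2 + 2 * A * B + 2 * B * C - 2 * A * C) / (4 * A * B * C))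
    (hK3 : K3 = (A ^ 2 + B ^ 2 - 3 * C ^ 2 - 2 * A * B + 2 * B * C + 2 * A * C) / (4 * A * B * C)) :
    (∃ κ : ℝ, IsDerivation (bra 1 1 1)
        (diagMap ![K2 * K3 - κ, K3 * K1 - κ, K1 * K2 - κ])) ↔ (A = B ∧ B = C) := by
  have hABC : 4 * A * B * C ≠ 0 := by positivity
  have e1 : (B - C) ^ 2 - 3 * A ^ 2 + 2 * A * B + 2 * A * C = 4 * A * B * C * K1 := by
    rw [hK1, mul_div_cancel₀ _ hABC]; ring
  have e2 : (C - A) ^ 2 - 3 * B ^ 2 + 2 * B * C + 2 * B * A = 4 * A * B * C * K2 := by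
    rw [hK2, mul_div_cancel₀ _ hABC]; ring
  have e3 : (A - B) ^ 2 - 3 * C ^ 2 + 2 * C * A + 2 * C * B = 4 * A * B * C * K3 := by
    rw [hK3, mul_div_cancel₀ _ hABC]; ring
  simp only [isDerivation_bra_one_diagMap_iff]
  constructor
  · rintro ⟨κ, h⟩
    have h1 : K2 * K3 - κ = 0 := congrFun h 0
    have h2 : K3 * K1 - κ = 0 := congrFun h 1
    have h3 : K1 * K2 - κ = 0 := congrFun h 2
    have n12 : ¬ (K1 = 0 ∧ K2 = 0) := fun ⟨z1, z2⟩ =>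
      not_two_curvatures_eq_zero hA hB hC (by rw [e1, z1, mul_zero]) (by rw [e2, z2, mul_zero])
    have n23 : ¬ (K2 = 0 ∧ K3 = 0) := fun ⟨z2, z3⟩ =>
      not_two_curvatures_eq_zero hB hC hA (by rw [e2, z2, mul_zero]) (by rw [e3, z3, mul_zero])
    have n31 : ¬ (K3 = 0 ∧ K1 = 0) := fun ⟨z3, z1⟩ =>
      not_two_curvatures_eq_zero hC hA hB (by rw [e3, z3, mul_zero]) (by rw [e1, z1, mul_zero])
    have c12 : K3 * (K1 - K2) = 0 := by linear_combination h2 - h1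
    have c23 : K1 * (K2 - K3) = 0 := by linear_combination h3 - h2
    have c31 : K2 * (K3 - K1) = 0 := by linear_combination h1 - h3
    have hK : K1 = K2 ∧ K2 = K3 := by grind
    exact eq_of_curvatures_eq hA hB hC (by rw [e1, e2, hK.1]) (by rw [e2, e3, hK.2])
  · rintro ⟨rfl, rfl⟩
    have h12 : K1 = K2 := mul_left_cancel₀ hABC (e1.symm.trans e2)
    have h23 : K2 = K3 := mul_left_cancel₀ hABC (e2.symm.trans e3)
    refine ⟨K3 * K3, ?_⟩
    ext i
    fin_cases i <;> simp [h12, h23]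
end
end

section
/- Let A, B, C > 0 and set K₁ = −(3A² − B² + 2BC − C² − 2AB − 2AC)/(4ABC), K₂ = (A² − 3B² + C² + 2AB + 2BC − 2AC)/(4ABC), K₃ = (A² + B² − 3C² − 2AB + 2BC + 2AC)/(4ABC). Then at most one of K₁, K₂, K₃ is equal to zero; i.e., there is no left-invariant metric on SU(2) for which two or more of the three principal sectional curvatures vanish. -/
noncomputable section

/-- The numerators of two principal sectional curvatures cannot vanish together. -/
theorem not_two_curvature_numerators_eq_zero {A B C : ℝ} (hA : 0 < A) (hB : 0 < B) (hC : 0 < C)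
    (h₁ : -3 * A ^ 2 + B ^ 2 + C ^ 2 - 2 * B * C + 2 * A * B + 2 * A * C = 0)
    (h₂ : A ^ 2 - 3 * B ^ 2 + C ^ 2 + 2 * A * B + 2 * B * C - 2 * A * C = 0) : False := by
  have hsq : C ^ 2 = (A - B) ^ 2 := by linarith
  have hmul : (A - B) * (A + B - C) = 0 := by linarith
  rcases mul_eq_zero.mp hmul with h | h
  · rw [h] at hsq
    nlinarith
  · obtain rfl : C = A + B := by linarith
    nlinarith [mul_pos hA hB]

/-- For `A, B, C > 0`, at most one of the principal sectional curvatures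
`K₁, K₂, K₃` of the metric `A θ¹⊗θ¹ + B θ²⊗θ² + C θ³⊗θ³` on `SU(2)` vanishes: no
left-invariant metric on `SU(2)` has two or more vanishing principal sectional curvatures. -/
theorem su2_at_most_one_vanishing_curvature (A B C K1 K2 K3 : ℝ)
    (hA : 0 < A) (hB : 0 < B) (hC : 0 < C)
    (hK1 : K1 = -(3 * A ^ 2 - B ^ 2 + 2 * B * C - C ^ 2 - 2 * A * B - 2 * A * C) / (4 * A * B * C))
    (hK2 : K2 = (A ^ 2 - 3 * B ^ 2 + C ^ 2 + 2 * A * B + 2 * B * C - 2 * A * C) / (4 * A * B * C))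
    (hK3 : K3 = (A ^ 2 + B ^ 2 - 3 * C ^ 2 - 2 * A * B + 2 * B * C + 2 * A * C) / (4 * A * B * C)) :
    ¬(K1 = 0 ∧ K2 = 0) ∧ ¬(K2 = 0 ∧ K3 = 0) ∧ ¬(K1 = 0 ∧ K3 = 0) := by
  have hD : 4 * A * B * C ≠ 0 := by positivity
  have zero_of_div {x y : ℝ} (hx : x = y / (4 * A * B * C)) (h : x = 0) : y = 0 :=
    (div_eq_zero_iff.mp (hx.symm.trans h)).resolve_right hD
  refine ⟨fun ⟨h₁, h₂⟩ => ?_, fun ⟨h₂, h₃⟩ => ?_, fun ⟨h₁, h₃⟩ => ?_⟩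
  · have n₁ := zero_of_div hK1 h₁
    have n₂ := zero_of_div hK2 h₂
    exact not_two_curvature_numerators_eq_zero hA hB hC (by linarith) (by linarith)
  · have n₂ := zero_of_div hK2 h₂
    have n₃ := zero_of_div hK3 h₃
    exact not_two_curvature_numerators_eq_zero hB hC hA (by linarith) (by linarith)
  · have n₁ := zero_of_div hK1 h₁
    have n₃ := zero_of_div hK3 h₃
    exact not_two_curvature_numerators_eq_zero hA hC hB (by linarith) (by linarith)
end
end

section
/- Let F be the linear map on the Lie algebra 𝔢(1,1) determined by F(e₁) = √3 e₃, F(e₂) = e₂, F(e₃) = √3 e₁. Then F is a Lie algebra automorphism of 𝔢(1,1), and for every B > 0, the symmetric bilinear forms g = 3 θ¹⊗θ¹ + B θ²⊗θ² + θ³⊗θ³ and g' = (1/3) θ¹⊗θ¹ + B θ²⊗θ² + θ³⊗θ³ (diagonal in the basis e₁, e₂, e₃) satisfy g'(F x, F y) = g(x, y) for all x, y ∈ 𝔢(1,1). Hence the left-invariant metrics 3 θ¹⊗θ¹ + B θ²⊗θ² + θ³⊗θ³ and (1/3) θ¹⊗θ¹ + B θ²⊗θ² + θ³⊗θ³ on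 E(1,1) are isometric via an automorphism of the Lie algebra. -/
noncomputable section

/-- The linear map `F` on `𝔢(1,1)` determined by `F e₁ = √3 e₃`, `F e₂ = e₂`,
`F e₃ = √3 e₁`. -/
def Fmap (x : Fin 3 → ℝ) : Fin 3 → ℝ :=
  ![Real.sqrt 3 * x 2, x 1, Real.sqrt 3 * x 0]

/-- `F` is a Lie algebra automorphism of `𝔢(1,1)`, and for every `B > 0`
it pulls back the diagonal metric `(1/3) θ¹⊗θ¹ + B θ²⊗θ² + θ³⊗θ³` to
`3 θ¹⊗θ¹ + B θ²⊗θ² + θ³⊗θ³`; hence these two left-invariant metrics on `E(1,1)` are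
isometric via an automorphism of the Lie algebra. -/
theorem e11_metrics_isometric :
    (Function.Bijective Fmap ∧
      ∀ x y : Fin 3 → ℝ, Fmap (bra 1 0 (-1) x y) = bra 1 0 (-1) (Fmap x) (Fmap y)) ∧
    ∀ B : ℝ, 0 < B → ∀ x y : Fin 3 → ℝ,
      (1 / 3) * (Fmap x 0 * Fmap y 0) + B * (Fmap x 1 * Fmap y 1) + Fmap x 2 * Fmap y 2 =
        3 * (x 0 * y 0) + B * (x 1 * y 1) + x 2 * y 2 := by
  have h3 : √(3 : ℝ) ≠ 0 := by positivity
  have hsq : √(3 : ℝ) * √3 = 3 := Real.mul_self_sqrt (by norm_num)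
  refine ⟨⟨⟨fun x y h => ?_, fun y => ⟨![y 2 / √3, y 1, y 0 / √3], ?_⟩⟩, fun x y => ?_⟩,
    fun B _ x y => ?_⟩
  · have h0 := congrFun h 0
    have h1 := congrFun h 1
    have h2 := congrFun h 2
    simp [Fmap] at h0 h1 h2
    ext i
    fin_cases i <;> assumption
  · ext i
    fin_cases i <;> simp [Fmap] <;> field_simp
  · ext i
    fin_cases i <;> simp [Fmap, bra] <;> ring
  · simp only [Fmap, Matrix.cons_val]
    linear_combination (x 2 * y 2 / 3 + x 0 * y 0) * hsq
end
end
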